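/- Let k be a finite field, R a split local Frobenius k-algebra with maximal ideal m and residue map π : R → R/m ≅ k, Q = (I, E, s, t) a finite quiver, and α : I → ℕ a rank vector such that k contains a primitive |α|-th root of unity, where |α| = Σ_{i∈I} α(i). Let χ : k× → ℂ× be a group homomorphism of order exactly |α|, and define the linear character 1^χ : G_α(R) → ℂ× by 1^χ(g) = χ(∏_{i∈I} det(π(g_i))), where π is applied entrywise to matrices. Then the dimension of the complex vector space {f : Rep^α(Q,R) → ℂ | for all g ∈ G_α(R) and all x ∈ Rep^α(Q,R), f(g^{-1}·x) = 1^χ(g)·f(x)} equals a_α(RQ), the number of G_α(R)-orbits of absolutely indecomposable representations in Rep^α(Q,R). -/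

import Mathlib

open Matrix

/-- The space of locally free representations of rank `α` of the quiver with vertex set `I`,
arrow set `E`, source map `s` and target map `t`, over the commutative ring `S`. -/
abbrev QRep (I E : Type) (s t : E → I) (α : I → ℕ) (S : Type) [CommRing S] : Type :=
  ∀ a : E, Matrix (Fin (α (t a))) (Fin (α (s a))) S

/-- The group `G_α(S) = ∏_i GL_{α i}(S)`. -/
abbrev QGl (I : Type) (α : I → ℕ) (S : Type) [CommRing S] : Type :=
  ∀ i : I, (Matrix (Fin (α i)) (Fin (α i)) S)ˣ

/-- The action of `G_α(S)` on representations: `(g • M)_a = g_{t a} * M_a * g_{s a}⁻¹`. -/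
def QAct {I E : Type} (s t : E → I) (α : I → ℕ) {S : Type} [CommRing S]
    (g : QGl I α S) (M : QRep I E s t α S) : QRep I E s t α S :=
  fun a => (g (t a)).val * M a * (g (s a)).inv

/-- A representation is decomposable if, after acting by some `g ∈ G_α(S)`, it is
simultaneously block-diagonal with respect to a nontrivial splitting `α = β + γ`. -/
def QDecomposable {I E : Type} (s t : E → I) (α : I → ℕ) (S : Type) [CommRing S]
    (M : QRep I E s t α S) : Prop :=
  ∃ β γ : I → ℕ, (∀ i, β i + γ i = α i) ∧ β ≠ 0 ∧ γ ≠ 0 ∧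
    ∃ g : QGl I α S, ∀ (a : E) (r : Fin (α (t a))) (c : Fin (α (s a))),
      (((r : ℕ) < β (t a) ∧ β (s a) ≤ (c : ℕ)) ∨ (β (t a) ≤ (r : ℕ) ∧ (c : ℕ) < β (s a))) →
      QAct s t α g M a r c = 0

/-- A representation over the `k`-algebra `R` is absolutely indecomposable if its entrywise
base change to `R ⊗_k k̄`, for `k̄` an algebraic closure of `k`, is indecomposable. -/
def QAbsInd (k : Type) [Field k] {I E : Type} (s t : E → I) (α : I → ℕ)
    (R : Type) [CommRing R] [Algebra k R] (M : QRep I E s t α R) : Prop :=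
  ¬ QDecomposable s t α (TensorProduct k R (AlgebraicClosure k))
      (fun a => (M a).map ⇑(algebraMap R (TensorProduct k R (AlgebraicClosure k))))

/-- `a_α(RQ)`: the number of `G_α(R)`-orbits of absolutely indecomposable representations. -/
noncomputable def aOrbits (k : Type) [Field k] (I E : Type) (s t : E → I) (α : I → ℕ)
    (R : Type) [CommRing R] [Algebra k R] : ℕ :=
  Nat.card {O : Set (QRep I E s t α R) //
    ∃ M : QRep I E s t α R, QAbsInd k s t α R M ∧
      O = {N | ∃ g : QGl I α R, N = QAct s t α g M}}

/-- The value `1^χ(g) = χ(∏_i det(π(g_i)))` of the linear character `1^χ` of `G_α(R)`,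
where `π : R →+* k` is the residue map (applied entrywise to matrices). -/
noncomputable def oneChi {k : Type} [Field k] {I : Type} [Fintype I] {α : I → ℕ}
    {R : Type} [CommRing R] (π : R →+* k) (χ : kˣ →* ℂˣ) (g : QGl I α R) : ℂˣ :=
  χ (∏ i : I, Units.map Matrix.detMonoidHom (Units.map (π.mapMatrix).toMonoidHom (g i)))


section Isotypic

variable {G X : Type} [Group G] [Finite X] (act : G → X → X) (ψ : G →* ℂˣ)

/-- The orbits of an action on whose point stabilizers the linear character `ψ` is trivial. -/
abbrev TrivialStabOrbit : Type :=
  {O : Set X // ∃ x, (∀ g, act g x = x → ψ g = 1) ∧ O = {y | ∃ g, y = act g x}}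

/-- The dimension of the `ψ`-isotypic component of the functions on a finite `G`-set is the number
of orbits on whose point stabilizers `ψ` is trivial. -/
theorem finrank_isotypic_eq_card (act_one : ∀ x, act 1 x = x)
    (act_mul : ∀ g h x, act (g * h) x = act g (act h x)) :
    Module.finrank ℂ
      ↥(⨅ g : G, LinearMap.ker
          (LinearMap.funLeft ℂ ℂ (fun x : X => act g⁻¹ x)
            - ((ψ g : ℂˣ) : ℂ) • (LinearMap.id : (X → ℂ) →ₗ[ℂ] (X → ℂ)))) =
    Nat.card (TrivialStabOrbit act ψ) := by
  classical
  set W := ⨅ g : G, LinearMap.ker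
          (LinearMap.funLeft ℂ ℂ (fun x : X => act g⁻¹ x)
            - ((ψ g : ℂˣ) : ℂ) • (LinearMap.id : (X → ℂ) →ₗ[ℂ] (X → ℂ))) with hW
  have inv_act : ∀ g x, act g⁻¹ (act g x) = x := fun g x => by
    rw [← act_mul, inv_mul_cancel, act_one]
  have act_inv : ∀ g x, act g (act g⁻¹ x) = x := fun g x => by
    rw [← act_mul, mul_inv_cancel, act_one]
  have memW : ∀ f : X → ℂ, f ∈ W ↔ ∀ g x, f x = (ψ g : ℂ) * f (act g x) := by
    intro f
    simp only [hW, Submodule.mem_iInf, LinearMap.mem_ker, LinearMap.sub_apply, funext_iff,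
      LinearMap.funLeft_apply, LinearMap.smul_apply, LinearMap.id_apply,
      Pi.smul_apply, smul_eq_mul, sub_eq_zero]
    refine forall_congr' fun g => ⟨fun h x => ?_, fun h x => ?_⟩
    · simpa [inv_act] using h (act g x)
    · simpa [act_inv] using h (act g⁻¹ x)
  choose rep hrep using fun O : TrivialStabOrbit act ψ => O.2
  let orb : X → Set X := fun x => {y | ∃ g, y = act g x}
  have orb_act : ∀ g x, orb (act g x) = orb x := by
    intro g x
    ext y
    constructor
    · rintro ⟨h, rfl⟩
      exact ⟨h * g, (act_mul _ _ _).symm⟩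
    · rintro ⟨h, rfl⟩
      exact ⟨h * g⁻¹, by rw [act_mul, inv_act]⟩
  have mem_orb : ∀ x, x ∈ orb x := fun x => ⟨1, (act_one x).symm⟩
  have stab : ∀ x, (∀ g, act g x = x → ψ g = 1) → ∀ g h, act g x = act h x → ψ g = ψ h := by
    intro x hx g h hgh
    have := hx (h⁻¹ * g) (by rw [act_mul, hgh, inv_act])
    rw [map_mul, map_inv] at this
    exact (inv_mul_eq_one.mp this).symm
  let restr : W →ₗ[ℂ] (TrivialStabOrbit act ψ → ℂ) :=
    { toFun := fun f O => f.1 (rep O)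
      map_add' := fun _ _ => rfl
      map_smul' := fun _ _ => rfl }
  have restr_inj : Function.Injective restr := by
    rw [← LinearMap.ker_eq_bot, LinearMap.ker_eq_bot']
    rintro ⟨f, hf⟩ h0
    have hf' := (memW f).mp hf
    ext x
    show f x = 0
    by_cases hx : ∀ g, act g x = x → ψ g = 1
    · have h := congr_fun h0 ⟨orb x, x, hx, rfl⟩
      obtain ⟨g, hg⟩ : x ∈ {y | ∃ g, y = act g (rep ⟨orb x, x, hx, rfl⟩)} :=
        (hrep ⟨orb x, x, hx, rfl⟩).2 ▸ mem_orb x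
      have h2 := hf' g (rep ⟨orb x, x, hx, rfl⟩)
      rw [← hg] at h2
      have h3 : f (rep ⟨orb x, x, hx, rfl⟩) = 0 := h
      rw [h3] at h2
      simpa using h2.symm
    · push Not at hx
      obtain ⟨g, hg, hne⟩ := hx
      have h2 := hf' g x
      rw [hg] at h2
      by_contra hfx
      apply hne
      ext
      exact (mul_right_cancel₀ hfx (by simpa using h2)).symm
  have restr_surj : Function.Surjective restr := by
    intro c
    let F : X → ℂ := fun x =>
      if h : ∃ O : TrivialStabOrbit act ψ, ∃ g, x = act g (rep O) then
        ((ψ h.choose_spec.choose)⁻¹ : ℂˣ) * c h.choose else 0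
    have uniq : ∀ (O O' : TrivialStabOrbit act ψ) g g',
        act g (rep O) = act g' (rep O') → O = O' := by
      intro O O' g g' h
      apply Subtype.ext
      rw [(hrep O).2, (hrep O').2]
      show orb _ = orb _
      rw [← orb_act g, h, orb_act]
    have F_eq : ∀ O g, F (act g (rep O)) = ((ψ g)⁻¹ : ℂˣ) * c O := by
      intro O g
      have h : ∃ O' : TrivialStabOrbit act ψ, ∃ g', act g (rep O) = act g' (rep O') :=
        ⟨O, g, rfl⟩
      have key : ∀ O' g', act g (rep O) = act g' (rep O') →
          ((ψ g')⁻¹ : ℂˣ) * c O' = ((ψ g)⁻¹ : ℂˣ) * c O := by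
        intro O' g' hg
        obtain rfl := uniq _ _ _ _ hg
        rw [stab _ (hrep O).1 _ _ hg]
      exact (dif_pos h).trans (key _ _ h.choose_spec.choose_spec)
    have hF : F ∈ W := by
      rw [memW]
      intro g x
      by_cases h : ∃ O : TrivialStabOrbit act ψ, ∃ g, x = act g (rep O)
      · obtain ⟨O, h', rfl⟩ := h
        rw [← act_mul, F_eq, F_eq, map_mul, _root_.mul_inv_rev, Units.val_mul]
        rw [mul_comm _ ((ψ g)⁻¹ : ℂˣ).val, ← mul_assoc, ← mul_assoc, Units.mul_inv, one_mul]
      · have h' : ¬ ∃ O : TrivialStabOrbit act ψ, ∃ g', act g x = act g' (rep O) := by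
          rintro ⟨O, g', hg⟩
          exact h ⟨O, g⁻¹ * g', by rw [act_mul, ← hg, inv_act]⟩
        rw [show F x = 0 from dif_neg h, show F (act g x) = 0 from dif_neg h', mul_zero]
    refine ⟨⟨F, hF⟩, ?_⟩
    ext O
    show F (rep O) = c O
    simpa [act_one] using F_eq O 1
  rw [(LinearEquiv.ofBijective restr ⟨restr_inj, restr_surj⟩).finrank_eq]
  have : Finite (TrivialStabOrbit act ψ) := Subtype.finite
  have := Fintype.ofFinite (TrivialStabOrbit act ψ)
  rw [Module.finrank_fintype_fun_eq_card, Nat.card_eq_fintype_card]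

end Isotypic

section MatrixAlgebra

open Polynomial

variable {N : Type} [Fintype N] [DecidableEq N]

theorem det_aeval_eq_prod_roots {K : Type} [Field K] [IsAlgClosed K] (B : Matrix N N K)
    (f : K[X]) : (aeval B f).det = (B.charpoly.roots.map fun c => f.eval c).prod := by
  have hcard : B.charpoly.roots.card = Fintype.card N := by
    rw [← (IsAlgClosed.splits B.charpoly).natDegree_eq_card_roots, charpoly_natDegree_eq_dim]
  let φ : K[X] →* K := Matrix.detMonoidHom.comp (aeval B).toRingHom.toMonoidHom
  let ψ : K[X] →* K :=
    { toFun := fun f => (B.charpoly.roots.map fun c => f.eval c).prod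
      map_one' := by simp
      map_mul' := fun f g => by simp [Multiset.prod_map_mul] }
  have hC : ∀ a, φ (C a) = ψ (C a) := by
    intro a
    simp [φ, ψ, hcard, Matrix.algebraMap_eq_diagonal]
  have hX : ∀ r, φ (X - C r) = ψ (X - C r) := by
    intro r
    have h1 : B.charpoly.eval r = (B.charpoly.roots.map fun c => r - c).prod := by
      conv_lhs => rw [(IsAlgClosed.splits B.charpoly).eq_prod_roots_of_monic B.charpoly_monic]
      simp [eval_multiset_prod]
    have h2 : (B - algebraMap K _ r).det = (-1) ^ Fintype.card N * B.charpoly.eval r := by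
      rw [eval_charpoly, ← Matrix.det_neg, neg_sub]
      rfl
    have h3 : (B.charpoly.roots.map fun c => c - r).prod
        = (-1) ^ Fintype.card N * (B.charpoly.roots.map fun c => r - c).prod := by
      simpa [hcard] using Multiset.prod_map_neg (B.charpoly.roots.map fun c => r - c)
    simp [φ, ψ, h2, h3, h1]
  show φ f = ψ f
  conv_lhs => rw [(IsAlgClosed.splits f).eq_prod_roots]
  conv_rhs => rw [(IsAlgClosed.splits f).eq_prod_roots]
  rw [map_mul, map_mul, hC, map_multiset_prod, map_multiset_prod, Multiset.map_map,
    Multiset.map_map]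
  simp only [Function.comp_def, hX]

theorem algebraMap_det_aeval {k K : Type} [Field k] [Field K] [Algebra k K] [IsAlgClosed K]
    (B : Matrix N N k) (f : k[X]) :
    algebraMap k K (aeval B f).det =
      ((B.charpoly.map (algebraMap k K)).roots.map fun c => aeval c f).prod := by
  have h := det_aeval_eq_prod_roots ((algebraMap k K).mapMatrix B) (f.map (algebraMap k K))
  have h2 : aeval ((algebraMap k K).mapMatrix B) (f.map (algebraMap k K)) =
      (algebraMap k K).mapMatrix (aeval B f) := by
    rw [aeval_map_algebraMap]
    exact aeval_algHom_apply (Algebra.ofId k K).mapMatrix B f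
  rw [h2, ← RingHom.map_det] at h
  rw [h, RingHom.mapMatrix_apply, charpoly_map]
  simp [eval_map_algebraMap]

theorem exists_det_aeval_eq_pow {k : Type} [Field k] [Finite k] (B : Matrix N N k)
    {p Q : k[X]} (hp : Irreducible p) (hmon : p.Monic) (m : ℕ) (hB : B.charpoly = p ^ m * Q)
    (hQ : ¬ p ∣ Q) (ω : k) : ∃ f : k[X], (aeval B f).det = ω ^ m := by
  have : Fact (Irreducible p) := ⟨hp⟩
  let pb := AdjoinRoot.powerBasis' hmon
  have : Module.Finite k (AdjoinRoot p) := pb.finite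
  have : Finite (AdjoinRoot p) := Module.finite_of_finite k
  obtain ⟨y, hy⟩ := FiniteField.norm_surjective k (AdjoinRoot p) ω
  obtain ⟨f₀, rfl⟩ := AdjoinRoot.mk_surjective y
  have hcop : IsCoprime p Q := (hp.coprime_iff_not_dvd).mpr hQ
  obtain ⟨u, v, huv⟩ := hcop
  let K := AlgebraicClosure k
  refine ⟨1 + v * Q * (f₀ - 1), (algebraMap k K).injective ?_⟩
  have hnorm : algebraMap k K ω =
      ((p.map (algebraMap k K)).roots.map fun c => aeval c f₀).prod := by
    rw [← hy, Algebra.norm_eq_matrix_det pb.basis]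
    have h1 : Algebra.leftMulMatrix pb.basis (AdjoinRoot.mk p f₀) =
        aeval (Algebra.leftMulMatrix pb.basis pb.gen) f₀ := by
      rw [aeval_algHom_apply]
      congr 1
      simp [pb]
    rw [h1, algebraMap_det_aeval (K := K), charpoly_leftMulMatrix]
    congr 3
    simp [pb, AdjoinRoot.minpoly_root hmon.ne_zero, hmon.leadingCoeff]
  have hne : B.charpoly.map (algebraMap k K) ≠ 0 := (B.charpoly_monic.map _).ne_zero
  rw [algebraMap_det_aeval (K := K), map_pow, hnorm]
  rw [hB, Polynomial.map_mul, Polynomial.map_pow] at hne ⊢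
  rw [roots_mul hne, Multiset.map_add, Multiset.prod_add, roots_pow]
  have hpr : ∀ c ∈ (p.map (algebraMap k K)).roots,
      aeval c (1 + v * Q * (f₀ - 1)) = aeval c f₀ := by
    intro c hc
    have hc' : aeval c p = 0 := by
      simpa [IsRoot, eval_map_algebraMap] using isRoot_of_mem_roots hc
    have := congrArg (aeval c) huv
    simp only [map_add, map_mul, hc', mul_zero, zero_add, map_one] at this
    simp [this]
  have hQr : ∀ c ∈ (Q.map (algebraMap k K)).roots,
      aeval c (1 + v * Q * (f₀ - 1)) = 1 := by
    intro c hc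
    have hc' : aeval c Q = 0 := by
      simpa [IsRoot, eval_map_algebraMap] using isRoot_of_mem_roots hc
    simp [hc']
  rw [Multiset.map_congr rfl hQr, Multiset.map_nsmul, Multiset.prod_nsmul,
    Multiset.map_congr rfl hpr]
  simp

end MatrixAlgebra

section TrivialCharacter

open Polynomial

variable {N : Type} [Fintype N] [DecidableEq N] {k : Type} [Field k]

theorem exists_isNilpotent_sub_algebraMap [Finite k] [Nonempty N] (A : Subalgebra k (Matrix N N k))
    (χ : kˣ →* ℂˣ) (hχ : orderOf χ = Fintype.card N)
    (hA : ∀ a ∈ A, ∀ u : kˣ, a.det = u → χ u = 1) {a : Matrix N N k} (ha : a ∈ A) :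
    ∃ c : k, IsNilpotent (a - algebraMap k _ c) := by
  have hN : 0 < Fintype.card N := Fintype.card_pos
  have hdeg := charpoly_natDegree_eq_dim a
  have hne := a.charpoly_monic.ne_zero
  obtain ⟨p, hmon, hp, hdvd⟩ := exists_monic_irreducible_factor a.charpoly
    (fun h => by have := natDegree_eq_zero_of_isUnit h; omega)
  obtain ⟨Q, hPQ, hQ⟩ :=
    (FiniteMultiplicity.of_not_isUnit hp.not_isUnit hne).exists_eq_pow_mul_and_not_dvd
  generalize multiplicity p a.charpoly = m at hPQ
  obtain ⟨ω, hω⟩ := IsCyclic.exists_generator (α := kˣ)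
  obtain ⟨f, hf⟩ := exists_det_aeval_eq_pow a hp hmon m hPQ hQ (ω : k)
  have h1 : χ (ω ^ m) = 1 := by
    refine hA (aeval a f) ?_ _ (by simpa using hf)
    exact aeval_mem_adjoin_singleton k a |> (Algebra.adjoin_le (by simpa using ha) ·)
  have h2 : χ ^ m = 1 := by
    ext u
    obtain ⟨j, rfl⟩ := Subgroup.mem_zpowers_iff.mp (hω u)
    rw [MonoidHom.pow_apply, ← map_pow, ← zpow_natCast, zpow_comm, map_zpow, zpow_natCast, h1]
    simp
  have h3 : Fintype.card N ∣ m := hχ ▸ orderOf_dvd_of_pow_eq_one h2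
  have hm : m ≠ 0 := by
    rintro rfl
    rw [pow_zero, one_mul] at hPQ
    exact hQ (hPQ ▸ hdvd)
  have hle : Fintype.card N ≤ m := Nat.le_of_dvd (Nat.pos_of_ne_zero hm) h3
  have hQ0 : Q ≠ 0 := fun h => hQ (h ▸ dvd_zero _)
  have hp1 : 0 < p.natDegree := hp.natDegree_pos
  rw [hPQ, natDegree_mul (pow_ne_zero _ hp.ne_zero) hQ0, natDegree_pow] at hdeg
  have hp2 : p.natDegree = 1 := by nlinarith
  have hQ1 : Q.natDegree = 0 := by rw [hp2] at hdeg; omega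
  obtain ⟨q, rfl⟩ := natDegree_eq_zero.mp hQ1
  refine ⟨-p.coeff 0, m, ?_⟩
  have h4 := aeval_self_charpoly a
  have hq : q ≠ 0 := by rintro rfl; simp at hQ0
  rw [hPQ, hmon.eq_X_add_C hp2] at h4
  simp only [map_mul, map_pow, map_add, aeval_X, aeval_C, Algebra.algebraMap_eq_smul_one q,
    mul_smul_comm, mul_one, smul_eq_zero, hq, false_or] at h4
  simpa using h4

theorem isNilpotent_of_mem_span_jacobson (A : Subalgebra k (Matrix N N k)) {K : Type} [Field K]
    [Algebra k K] {j : Matrix N N K}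
    (hj : j ∈ Submodule.span K ((algebraMap k K).mapMatrix '' ((↑) '' (Ring.jacobson A : Set A)))) :
    IsNilpotent j := by
  have : Module.Finite k A := inferInstance
  have : IsArtinianRing A := IsArtinianRing.of_finite k A
  obtain ⟨L, hL⟩ := IsSemiprimaryRing.isNilpotent (R := A)
  refine ⟨L, ?_⟩
  have key : ∀ l : ℕ, j ^ l ∈ Submodule.span K
      ((algebraMap k K).mapMatrix '' ((↑) '' ((Ring.jacobson A ^ l : Ideal A) : Set A))) := by
    intro l
    induction l with
    | zero =>
      refine Submodule.subset_span ⟨1, ⟨1, ?_, rfl⟩, by simp⟩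
      rw [Submodule.pow_zero, Ideal.one_eq_top]
      trivial
    | succ l ih =>
      rw [pow_succ]
      have := Submodule.mul_mem_mul ih hj
      rw [Submodule.span_mul_span] at this
      refine Submodule.span_mono ?_ this
      rintro _ ⟨_, ⟨_, ⟨x, hx, rfl⟩, rfl⟩, _, ⟨_, ⟨y, hy, rfl⟩, rfl⟩, rfl⟩
      refine ⟨_, ⟨x * y, ?_, rfl⟩, by simp⟩
      rw [Submodule.pow_succ]
      exact Ideal.mul_mem_mul hx hy
  have := key L
  rw [hL] at this
  simpa using this

theorem eq_zero_or_eq_one_of_mem_span [Finite k] [Nonempty N] (A : Subalgebra k (Matrix N N k))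
    (χ : kˣ →* ℂˣ) (hχ : orderOf χ = Fintype.card N)
    (hA : ∀ a ∈ A, ∀ u : kˣ, a.det = u → χ u = 1) {K : Type} [Field K] [Algebra k K]
    {e : Matrix N N K} (he : IsIdempotentElem e)
    (heA : e ∈ Submodule.span K ((algebraMap k K).mapMatrix '' (A : Set (Matrix N N k)))) :
    e = 0 ∨ e = 1 := by
  have scalar : ∀ a : A, ∃ c : k, IsNilpotent (a - algebraMap k A c) := by
    intro a
    obtain ⟨c, hc⟩ := exists_isNilpotent_sub_algebraMap A χ hχ hA a.2
    exact ⟨c, (IsNilpotent.map_iff (f := A.val) Subtype.val_injective).mp (by simpa using hc)⟩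
  have jac : ∀ x : A, IsNilpotent x → x ∈ Ring.jacobson A := by
    intro x hx
    rw [← Ideal.jacobson_bot, Ideal.mem_jacobson_iff]
    intro y
    obtain ⟨c, hc⟩ := scalar (y * x)
    have hc0 : c = 0 := by
      by_contra hc0
      have hu : IsUnit (algebraMap k A c) := (Ne.isUnit hc0).map _
      have hyx : IsUnit (y * x) := by
        have := hc.isUnit_add_left_of_commute hu (Algebra.commutes _ _).symm
        simpa using this
      obtain ⟨L, hL⟩ := hx
      obtain ⟨z, hz⟩ := hyx
      have h1 : ∀ l : ℕ, x ^ l = 0 → (1 : A) = 0 := by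
        intro l
        induction l with
        | zero => simp
        | succ l ih =>
          intro h
          apply ih
          have : (z : A) * x ^ l = 0 := by rw [hz, mul_assoc, ← pow_succ', h, mul_zero]
          simpa using this
      exact one_ne_zero (h1 L hL)
    subst hc0
    rw [map_zero, sub_zero] at hc
    obtain ⟨z, hz⟩ := hc.isUnit_add_one
    refine ⟨z⁻¹.val, ?_⟩
    rw [Ideal.mem_bot, mul_assoc, ← mul_add_one, ← hz, Units.inv_mul, sub_self]
  obtain ⟨c, j, hj, rfl⟩ : ∃ c : K, ∃ j, IsNilpotent j ∧ e = algebraMap K _ c + j := by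
    have h : ∃ c : K, ∃ j ∈ Submodule.span K
        ((algebraMap k K).mapMatrix '' ((↑) '' (Ring.jacobson A : Set A))),
        e = algebraMap K _ c + j := by
      clear he
      induction heA using Submodule.span_induction with
      | mem x hx =>
        obtain ⟨a, ha, rfl⟩ := hx
        obtain ⟨c, hc⟩ := scalar ⟨a, ha⟩
        refine ⟨algebraMap k K c, _, Submodule.subset_span ⟨_, ⟨_, jac _ hc, rfl⟩, rfl⟩, ?_⟩
        ext i j
        simp [Matrix.algebraMap_matrix_apply, apply_ite (algebraMap k K)]
      | zero => exact ⟨0, 0, zero_mem _, by simp⟩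
      | add x y _ _ hx hy =>
        obtain ⟨c, j, hj, rfl⟩ := hx
        obtain ⟨d, l, hl, rfl⟩ := hy
        exact ⟨c + d, j + l, add_mem hj hl, by rw [map_add]; abel⟩
      | smul r x _ hx =>
        obtain ⟨c, j, hj, rfl⟩ := hx
        exact ⟨r * c, r • j, Submodule.smul_mem _ _ hj, by
          rw [smul_add, map_mul, Algebra.smul_def r (algebraMap K _ c)]⟩
    obtain ⟨c, j, hj, rfl⟩ := h
    exact ⟨c, j, isNilpotent_of_mem_span_jacobson A hj, rfl⟩
  have idem_nil : ∀ x : Matrix N N K, IsIdempotentElem x → IsNilpotent x → x = 0 := by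
    rintro x hx ⟨l, hl⟩
    rw [← hx.pow_succ_eq l, pow_succ, hl, zero_mul]
  have hcj : Commute (algebraMap K _ c) j := Algebra.commutes _ _
  have hnil : IsNilpotent (algebraMap K (Matrix N N K) (c * c - c)) := by
    have h1 : algebraMap K (Matrix N N K) (c * c - c) =
        j * (1 - algebraMap K _ c - algebraMap K _ c - j) := by
      have h2 := he.eq
      rw [add_mul, mul_add, mul_add, hcj.eq] at h2
      have h3 : algebraMap K (Matrix N N K) (c * c - c) = algebraMap K _ c * algebraMap K _ c
          - (algebraMap K _ c) := by rw [map_sub, map_mul]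
      rw [h3, mul_sub, mul_sub, mul_sub, mul_one]
      rw [sub_eq_iff_eq_add, ← sub_eq_zero, ← sub_eq_zero.mpr h2]
      abel
    rw [h1]
    refine Commute.isNilpotent_mul_right ?_ hj
    exact (((Commute.one_right j).sub_right hcj.symm).sub_right hcj.symm).sub_right
      (Commute.refl j)
  rw [IsNilpotent.map_iff (algebraMap K (Matrix N N K)).injective] at hnil
  have hc : c * (c - 1) = 0 := by rw [mul_sub, mul_one]; exact hnil.eq_zero
  rcases mul_eq_zero.mp hc with rfl | h
  · left
    rw [map_zero, zero_add] at he ⊢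
    exact idem_nil _ he hj
  · right
    obtain rfl := sub_eq_zero.mp h
    have := idem_nil (-j) (by simpa using he.one_sub) hj.neg
    rw [neg_eq_zero.mp this, map_one, add_zero]

end TrivialCharacter

section Eigenvalues

open Polynomial

variable {N : Type} [Fintype N] [DecidableEq N]

theorem exists_isIdempotentElem_aeval {K : Type} [Field K] {B : Type} [Ring B] [Algebra K B]
    (Φ : B →ₐ[K] Matrix N N K) {g : B} (hg : IsIntegral K g) {c d : K}
    (hc : c ∈ spectrum K (Φ g)) (hd : d ∈ spectrum K (Φ g)) (hcd : c ≠ d) :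
    ∃ f : K[X], IsIdempotentElem (aeval g f) ∧ aeval g f ≠ 0 ∧ aeval g f ≠ 1 := by
  have hN : Nonempty N := by
    by_contra h
    have := not_nonempty_iff.mp h
    simp [spectrum.of_subsingleton] at hc
  have mem_spec : ∀ (f : K[X]) {x}, x ∈ spectrum K (Φ g) →
      f.eval x ∈ spectrum K (Φ (aeval g f)) := by
    intro f x hx
    rw [← aeval_algHom_apply]
    exact spectrum.subset_polynomial_aeval _ _ ⟨x, hx, rfl⟩
  have root : ∀ {x}, x ∈ spectrum K (Φ g) → (minpoly K g).eval x = 0 := by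
    intro x hx
    have := mem_spec (minpoly K g) hx
    rw [minpoly.aeval, map_zero, spectrum.zero_eq] at this
    exact this
  obtain ⟨F, hF, hFc⟩ := exists_eq_pow_rootMultiplicity_mul_and_not_dvd (minpoly K g)
    (minpoly.ne_zero hg) c
  generalize rootMultiplicity c (minpoly K g) = m at hF
  have hcop : IsCoprime ((X - C c) ^ m) F :=
    ((irreducible_X_sub_C c).coprime_iff_not_dvd.mpr hFc).pow_left
  obtain ⟨u, v, huv⟩ := hcop
  have hFc0 : F.eval c ≠ 0 := fun h => hFc (dvd_iff_isRoot.mpr h)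
  have hm : m ≠ 0 := by
    rintro rfl
    have := root hc
    rw [hF] at this
    simp [hFc0] at this
  have hd' : F.eval d = 0 := by
    have := root hd
    rw [hF] at this
    simpa [sub_ne_zero.mpr hcd.symm, hm] using this
  have hc1 : (v * F).eval c = 1 := by
    have := congrArg (eval c) huv
    simpa [hm] using this
  have hd1 : (v * F).eval d = 0 := by simp [hd']
  refine ⟨v * F, ?_, fun h => ?_, fun h => ?_⟩
  · have h1 : (v * F) * (v * F) = v * F - u * v * minpoly K g := by
      rw [hF]
      linear_combination (v * F) * huv
    rw [IsIdempotentElem, ← map_mul, h1, map_sub, map_mul _ _ (minpoly K g), minpoly.aeval,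
      mul_zero, sub_zero]
  · have := mem_spec (v * F) hc
    rw [h, hc1, map_zero, spectrum.zero_eq] at this
    exact one_ne_zero this
  · have := mem_spec (v * F) hd
    rw [h, hd1, map_one, spectrum.one_eq] at this
    exact zero_ne_one this

theorem exists_det_eq_pow_card {k K : Type} [Field k] [Field K] [Algebra k K] [IsAlgClosed K]
    (hN : (Fintype.card N : k) ≠ 0) (B : Matrix N N k)
    (hB : ∀ c ∈ spectrum K ((algebraMap k K).mapMatrix B),
      ∀ d ∈ spectrum K ((algebraMap k K).mapMatrix B), c = d) :
    ∃ c : k, B.det = c ^ Fintype.card N := by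
  set B' := (algebraMap k K).mapMatrix B with hB'
  have hcard : B'.charpoly.roots.card = Fintype.card N := by
    rw [← (IsAlgClosed.splits B'.charpoly).natDegree_eq_card_roots, charpoly_natDegree_eq_dim]
  have hmem : ∀ c ∈ B'.charpoly.roots, c ∈ spectrum K B' := fun c hc =>
    mem_spectrum_iff_isRoot_charpoly.mpr (isRoot_of_mem_roots hc)
  obtain ⟨c, hc⟩ : ∃ c, c ∈ B'.charpoly.roots := by
    refine Multiset.exists_mem_of_ne_zero fun h => hN ?_
    rw [← hcard, h]
    simp
  have hroots : B'.charpoly.roots = Multiset.replicate (Fintype.card N) c :=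
    Multiset.eq_replicate.mpr ⟨hcard, fun d hd => hB _ (hmem d hd) _ (hmem c hc)⟩
  have htr : algebraMap k K B.trace = Fintype.card N * c := by
    have := trace_eq_sum_roots_charpoly B'
    rw [hroots, Multiset.sum_replicate, nsmul_eq_mul] at this
    rw [← this, hB', AddMonoidHom.map_trace (algebraMap k K)]
    rfl
  have hdet : algebraMap k K B.det = c ^ Fintype.card N := by
    rw [RingHom.map_det, det_eq_prod_roots_charpoly, hroots, Multiset.prod_replicate]
  have hc' : algebraMap k K ((Fintype.card N : k)⁻¹ * B.trace) = c := by
    rw [map_mul, htr, map_inv₀, map_natCast, inv_mul_cancel_left₀]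
    simpa using (map_ne_zero (algebraMap k K)).mpr hN
  refine ⟨(Fintype.card N : k)⁻¹ * B.trace, (algebraMap k K).injective ?_⟩
  rw [hdet, map_pow, hc']

end Eigenvalues

section Idempotents

theorem exists_conj_eq_diagonal {S : Type} [CommRing S] [IsLocalRing S] {n : ℕ}
    {e : Matrix (Fin n) (Fin n) S} (he : IsIdempotentElem e) :
    ∃ b ≤ n, ∃ g : (Matrix (Fin n) (Fin n) S)ˣ,
      g.val * e * g.inv = diagonal fun r : Fin n => if (r : ℕ) < b then 1 else 0 := by
  have hf : IsIdempotentElem (Matrix.toLin' e) := by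
    rw [IsIdempotentElem, Module.End.mul_eq_comp, ← Matrix.toLin'_mul, he.eq]
  have free_range : ∀ f : Module.End S (Fin n → S), IsIdempotentElem f →
      Module.Free S (LinearMap.range f) := by
    intro f hf
    have : Module.Projective S (LinearMap.range f) := by
      refine Module.Projective.of_split (LinearMap.range f).subtype f.rangeRestrict ?_
      ext1 ⟨_, x, rfl⟩
      exact Subtype.ext (LinearMap.congr_fun hf.eq x)
    exact Module.free_of_flat_of_isLocalRing
  set f := Matrix.toLin' e with hfe
  have := free_range f hf
  have := free_range (1 - f) hf.one_sub
  have hcompl : IsCompl (LinearMap.range f) (LinearMap.range (1 - f)) := by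
    rw [← LinearMap.IsIdempotentElem.ker_eq_range_one_sub hf]
    exact LinearMap.IsIdempotentElem.isCompl hf
  let b := Module.finrank S (LinearMap.range f)
  let c := Module.finrank S (LinearMap.range (1 - f))
  let B₀ : Module.Basis (Fin b ⊕ Fin c) S (Fin n → S) :=
    ((Module.finBasis S (LinearMap.range f)).prod
      (Module.finBasis S (LinearMap.range (1 - f)))).map
      (Submodule.prodEquivOfIsCompl _ _ hcompl)
  have hbc : b + c = n := by
    have := Module.finrank_eq_card_basis B₀
    simpa using this.symm
  let B : Module.Basis (Fin n) S (Fin n → S) :=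
    B₀.reindex (finSumFinEquiv.trans (finCongr hbc))
  have hB : ∀ j : Fin n, e *ᵥ (B j) = (if (j : ℕ) < b then 1 else 0 : S) • B j := by
    intro j
    obtain ⟨i, rfl⟩ := (finSumFinEquiv.trans (finCongr hbc)).surjective j
    rw [← Matrix.toLin'_apply, ← hfe]
    rcases i with i | i
    · have h1 : B (finSumFinEquiv.trans (finCongr hbc) (Sum.inl i)) =
          (Module.finBasis S (LinearMap.range f) i : Fin n → S) := by simp [B, B₀]
      obtain ⟨x, hx⟩ := (Module.finBasis S (LinearMap.range f) i).2
      rw [h1, ← hx]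
      have : f (f x) = f x := LinearMap.congr_fun hf.eq x
      simp [this]
    · have h1 : B (finSumFinEquiv.trans (finCongr hbc) (Sum.inr i)) =
          (Module.finBasis S (LinearMap.range (1 - f)) i : Fin n → S) := by simp [B, B₀]
      obtain ⟨x, hx⟩ := (Module.finBasis S (LinearMap.range (1 - f)) i).2
      rw [h1, ← hx]
      have : f (f x) = f x := LinearMap.congr_fun hf.eq x
      simp [this]
  let P : Matrix (Fin n) (Fin n) S := (Pi.basisFun S (Fin n)).toMatrix B
  let P' : Matrix (Fin n) (Fin n) S := B.toMatrix (Pi.basisFun S (Fin n))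
  have hP : P' * P = 1 := Module.Basis.toMatrix_mul_toMatrix_flip _ _
  have hP' : P * P' = 1 := Module.Basis.toMatrix_mul_toMatrix_flip _ _
  refine ⟨b, hbc ▸ Nat.le_add_right _ _, ⟨P', P, hP, hP'⟩, ?_⟩
  have h : e * P = P * diagonal fun r : Fin n => if (r : ℕ) < b then 1 else 0 := by
    ext i j
    have := congr_fun (hB j) i
    rw [mul_diagonal, mul_comm]
    exact this
  show P' * e * P = _
  rw [mul_assoc, h, ← mul_assoc, hP, one_mul]

end Idempotents

section Endomorphisms

variable {I E : Type} {s t : E → I} {α : I → ℕ}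

/-- The endomorphism algebra of a locally free representation. -/
def QEnd (F : Type) [CommRing F] {S : Type} [CommRing S] [Algebra F S] (M : QRep I E s t α S) :
    Subalgebra F (∀ i, Matrix (Fin (α i)) (Fin (α i)) S) where
  carrier := {X | ∀ a, X (t a) * M a = M a * X (s a)}
  mul_mem' {X Y} hX hY a := by
    rw [Pi.mul_apply, Pi.mul_apply, Matrix.mul_assoc, hY, ← Matrix.mul_assoc, hX, Matrix.mul_assoc]
  add_mem' {X Y} hX hY a := by
    rw [Pi.add_apply, Pi.add_apply, Matrix.add_mul, Matrix.mul_add, hX, hY]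
  algebraMap_mem' r a := by
    simp [Algebra.algebraMap_eq_smul_one]

theorem QAct_eq_self_iff {S : Type} [CommRing S] (M : QRep I E s t α S) (g : QGl I α S) :
    QAct s t α g M = M ↔ ∀ a, (g (t a)).val * M a = M a * (g (s a)).val := by
  rw [funext_iff]
  refine forall_congr' fun a => ?_
  constructor
  · intro h
    conv_rhs => rw [← h]
    rw [QAct, Matrix.mul_assoc, Units.inv_val, Matrix.mul_one]
  · intro h
    rw [QAct, h, Matrix.mul_assoc, Units.val_inv, Matrix.mul_one]

theorem qDecomposable_iff {S : Type} [CommRing S] [IsLocalRing S] (M : QRep I E s t α S) :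
    QDecomposable s t α S M ↔ ∃ e ∈ QEnd S M, IsIdempotentElem e ∧ e ≠ 0 ∧ e ≠ 1 := by
  constructor
  · rintro ⟨β, γ, hβγ, hβ, hγ, g, hg⟩
    let D : ∀ i, Matrix (Fin (α i)) (Fin (α i)) S :=
      fun i => diagonal fun r => if (r : ℕ) < β i then 1 else 0
    have hD : ∀ i, D i * D i = D i := fun i => by
      rw [diagonal_mul_diagonal]
      congr 1
      funext r
      split_ifs <;> simp
    have hDM : ∀ a, D (t a) * QAct s t α g M a = QAct s t α g M a * D (s a) := by
      intro a
      ext r c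
      rw [diagonal_mul, mul_diagonal]
      have := hg a r c
      by_cases h1 : (r : ℕ) < β (t a) <;> by_cases h2 : (c : ℕ) < β (s a) <;>
        simp_all
    refine ⟨fun i => (g i).inv * D i * (g i).val, fun a => ?_, ?_, fun h => hβ ?_, fun h => hγ ?_⟩
    · have h1 : (g (t a)).val * M a = QAct s t α g M a * (g (s a)).val := by
        rw [QAct, Matrix.mul_assoc, Units.inv_val, Matrix.mul_one]
      have h2 : M a * (g (s a)).inv = (g (t a)).inv * QAct s t α g M a := by
        rw [QAct, ← Matrix.mul_assoc, ← Matrix.mul_assoc, Units.inv_val, Matrix.one_mul]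
      show (g (t a)).inv * D (t a) * (g (t a)).val * M a =
        M a * ((g (s a)).inv * D (s a) * (g (s a)).val)
      rw [Matrix.mul_assoc _ _ (M a), h1, ← Matrix.mul_assoc (M a), ← Matrix.mul_assoc (M a), h2,
        Matrix.mul_assoc (g (t a)).inv (QAct _ _ _ _ _ _), ← hDM]
      simp only [Matrix.mul_assoc]
    · funext i
      show (g i).inv * D i * (g i).val * ((g i).inv * D i * (g i).val) = _
      rw [Matrix.mul_assoc, ← Matrix.mul_assoc (g i).val, ← Matrix.mul_assoc (g i).val, Units.val_inv, Matrix.one_mul,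
        Matrix.mul_assoc, ← Matrix.mul_assoc (D i), hD, ← Matrix.mul_assoc]
    · funext i
      by_contra hi
      have hi' : 0 < α i := by have := hβγ i; simp at hi; omega
      have h1 : (g i).inv * D i * (g i).val = 0 := congr_fun h i
      have h2 : D i = 0 := by
        have := congrArg (fun x => (g i).val * x * (g i).inv) h1
        simpa [Matrix.mul_assoc] using this
      have := congr_fun (congr_fun h2 ⟨0, hi'⟩) ⟨0, hi'⟩
      simp only [D, diagonal_apply_eq, Matrix.zero_apply] at this
      rw [if_pos (Nat.pos_of_ne_zero hi)] at this
      exact one_ne_zero this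
    · funext i
      by_contra hi
      have hi' : β i < α i := by have := hβγ i; simp at hi; omega
      have h1 : (g i).inv * D i * (g i).val = 1 := congr_fun h i
      have h2 : D i = 1 := by
        have := congrArg (fun x => (g i).val * x * (g i).inv) h1
        simpa [Matrix.mul_assoc] using this
      have := congr_fun (congr_fun h2 ⟨β i, hi'⟩) ⟨β i, hi'⟩
      simp [D] at this
  · rintro ⟨e, heM, he, he0, he1⟩
    choose β hβ g hg using fun i => exists_conj_eq_diagonal (congr_fun he i : IsIdempotentElem (e i))
    refine ⟨β, fun i => α i - β i, fun i => Nat.add_sub_of_le (hβ i), fun h => he0 ?_,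
      fun h => he1 ?_, g, fun a r c hrc => ?_⟩
    · funext i
      have h1 := hg i
      have h2 : β i = 0 := congr_fun h i
      simp only [h2, not_lt_zero, if_false, diagonal_zero] at h1
      have := congrArg (fun x => (g i).inv * x * (g i).val) h1
      simpa [Matrix.mul_assoc] using this
    · funext i
      have h1 := hg i
      have h2 : α i - β i = 0 := congr_fun h i
      have h3 : ∀ r : Fin (α i), (r : ℕ) < β i := fun r => by omega
      simp only [h3, if_true, diagonal_one] at h1
      have := congrArg (fun x => (g i).inv * x * (g i).val) h1
      simpa [Matrix.mul_assoc] using this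
    · have h1 : ∀ i, (g i).val * e i = (diagonal fun r : Fin (α i) => if (r : ℕ) < β i then (1 : S) else 0) *
          (g i).val := fun i => by
        rw [← hg, Matrix.mul_assoc, Matrix.mul_assoc, Units.inv_val, Matrix.mul_one]
      have h2 : ∀ i, e i * (g i).inv = (g i).inv *
          (diagonal fun r : Fin (α i) => if (r : ℕ) < β i then (1 : S) else 0) := fun i => by
        rw [← hg, ← Matrix.mul_assoc, ← Matrix.mul_assoc, Units.inv_val, Matrix.one_mul]
      have h3 : (diagonal fun r : Fin (α (t a)) => if (r : ℕ) < β (t a) then (1 : S) else 0) *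
          QAct s t α g M a = QAct s t α g M a *
            (diagonal fun r : Fin (α (s a)) => if (r : ℕ) < β (s a) then (1 : S) else 0) := by
        rw [QAct, ← Matrix.mul_assoc, ← Matrix.mul_assoc, ← h1, Matrix.mul_assoc _ (e (t a)), heM a,
          Matrix.mul_assoc _ _ (g (s a)).inv, Matrix.mul_assoc (M a), h2]
        simp only [Matrix.mul_assoc]
      have h4 := congr_fun (congr_fun h3 r) c
      rw [diagonal_mul, mul_diagonal] at h4
      rcases hrc with ⟨h5, h6⟩ | ⟨h5, h6⟩
      · simpa [h5, h6.not_gt] using h4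
      · simpa [h5.not_gt, h6] using h4.symm

end Endomorphisms

section BlockMap

variable {I : Type} [Fintype I] [DecidableEq I] {α : I → ℕ}

theorem det_blockDiagonal'_fin {L : Type} [CommRing L]
    (X : ∀ i, Matrix (Fin (α i)) (Fin (α i)) L) :
    (blockDiagonal' X).det = ∏ i, (X i).det := by
  let : LinearOrder I := LinearOrder.lift' (Fintype.equivFin I) (Fintype.equivFin I).injective
  rw [(blockTriangular_blockDiagonal' X).det_fintype]
  refine Finset.prod_congr rfl fun i _ => ?_
  let e : Fin (α i) ≃ {a : Σ i, Fin (α i) // a.1 = i} :=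
    { toFun := fun r => ⟨⟨i, r⟩, rfl⟩
      invFun := fun a => a.2 ▸ a.1.2
      left_inv := fun r => rfl
      right_inv := by rintro ⟨⟨j, r⟩, rfl⟩; rfl }
  rw [← det_submatrix_equiv_self e]
  congr 1
  ext r c
  simp [e, toSquareBlock_def]

/-- The block-diagonal matrix over `L` obtained from a family of square matrices over `S` by
applying an algebra map `S → L` entrywise. -/
def blockMap {F S L : Type} [CommRing F] [CommRing S] [CommRing L] [Algebra F S] [Algebra F L]
    (ρ : S →ₐ[F] L) :
    (∀ i, Matrix (Fin (α i)) (Fin (α i)) S) →ₐ[F]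
      Matrix (Σ i, Fin (α i)) (Σ i, Fin (α i)) L where
  __ := (blockDiagonal'RingHom (fun i => Fin (α i)) L).comp
    (RingHom.pi fun i => (ρ : S →+* L).mapMatrix.comp (Pi.evalRingHom _ i))
  commutes' r := by
    have h : ∀ i, (algebraMap F (Matrix (Fin (α i)) (Fin (α i)) S) r).map ρ =
        algebraMap F (Matrix (Fin (α i)) (Fin (α i)) L) r := fun i =>
      (ρ.mapMatrix (m := Fin (α i))).commutes r
    refine Eq.trans (congrArg blockDiagonal' (funext h)) ?_
    ext ⟨i, a⟩ ⟨j, b⟩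
    by_cases hij : i = j
    · subst hij
      by_cases hab : a = b <;> simp [blockDiagonal'_apply, algebraMap_matrix_apply, hab]
    · simp [blockDiagonal'_apply, algebraMap_matrix_apply, hij]

theorem blockMap_apply {F S L : Type} [CommRing F] [CommRing S] [CommRing L] [Algebra F S]
    [Algebra F L] (ρ : S →ₐ[F] L) (X : ∀ i, Matrix (Fin (α i)) (Fin (α i)) S) :
    blockMap ρ X = blockDiagonal' fun i => (X i).map ρ := rfl

theorem det_blockMap {F S L : Type} [CommRing F] [CommRing S] [CommRing L] [Algebra F S]
    [Algebra F L] (ρ : S →ₐ[F] L) (X : ∀ i, Matrix (Fin (α i)) (Fin (α i)) S) :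
    (blockMap ρ X).det = ∏ i, ρ (X i).det := by
  rw [blockMap_apply, det_blockDiagonal'_fin]
  exact Finset.prod_congr rfl fun i _ => (ρ.map_det (X i)).symm

theorem eq_zero_of_blockMap_eq_zero {F S L : Type} [CommRing F] [CommRing S] [Field L]
    [Algebra F S] [Algebra F L] (ρ : S →ₐ[F] L) (hρ : ∀ x, ρ x ≠ 0 → IsUnit x)
    {e : ∀ i, Matrix (Fin (α i)) (Fin (α i)) S} (he : IsIdempotentElem e)
    (h : blockMap ρ e = 0) : e = 0 := by
  funext i
  have h0 : (e i).map ρ = 0 := congr_fun (blockDiagonal'_injective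
    ((blockMap_apply ρ e).symm.trans (h.trans blockDiagonal'_zero.symm))) i
  have h1 : IsUnit (1 - e i) := by
    rw [isUnit_iff_isUnit_det]
    refine hρ _ ?_
    rw [AlgHom.map_det, map_sub, map_one, AlgHom.mapMatrix_apply, h0]
    simp
  refine h1.mul_right_eq_zero.mp ?_
  have h2 : e i * e i = e i := congr_fun he i
  rw [sub_mul, one_mul, h2, sub_self]

theorem eq_one_of_blockMap_eq_one {F S L : Type} [CommRing F] [CommRing S] [Field L]
    [Algebra F S] [Algebra F L] (ρ : S →ₐ[F] L) (hρ : ∀ x, ρ x ≠ 0 → IsUnit x)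
    {e : ∀ i, Matrix (Fin (α i)) (Fin (α i)) S} (he : IsIdempotentElem e)
    (h : blockMap ρ e = 1) : e = 1 := by
  have := eq_zero_of_blockMap_eq_zero ρ hρ he.one_sub (by rw [map_sub, map_one, h, sub_self])
  exact (sub_eq_zero.mp this).symm

end BlockMap

section BaseChange

variable {I E : Type} [Fintype I] [DecidableEq I] {s t : E → I} {α : I → ℕ}
  {k R S K : Type} [Field k] [CommRing R] [Algebra k R] [Field K] [Algebra k K] [CommRing S]
  [Algebra R S] [Algebra K S] (π : R →ₐ[k] k) (ρ : S →ₐ[K] K)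

theorem blockMap_map (hρ : ∀ r, ρ (algebraMap R S r) = algebraMap k K (π r))
    (X : ∀ i, Matrix (Fin (α i)) (Fin (α i)) R) :
    blockMap ρ (fun i => (X i).map (algebraMap R S)) =
      (algebraMap k K).mapMatrix (blockMap π X) := by
  rw [blockMap_apply, blockMap_apply]
  ext ⟨i, a⟩ ⟨j, b⟩
  by_cases hij : i = j
  · subst hij
    simp [blockDiagonal'_apply, hρ]
  · simp [blockDiagonal'_apply, hij]

theorem blockMap_mem_span (hρ : ∀ r, ρ (algebraMap R S r) = algebraMap k K (π r))
    {κ : Type} (b : Module.Basis κ R S) (M : QRep I E s t α R)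
    {e : ∀ i, Matrix (Fin (α i)) (Fin (α i)) S}
    (he : e ∈ QEnd S (fun a => (M a).map (algebraMap R S) : QRep I E s t α S)) :
    blockMap ρ e ∈ Submodule.span K
      ((algebraMap k K).mapMatrix '' ((QEnd k M).map (blockMap π) : Set (Matrix _ _ k))) := by
  classical
  let X : κ → ∀ i, Matrix (Fin (α i)) (Fin (α i)) R := fun j i => (e i).map fun x => b.repr x j
  have hX : ∀ j, X j ∈ QEnd k M := by
    intro j a
    ext p q
    have := congrArg (fun x => b.repr x j) (congr_fun (congr_fun (he a) p) q)
    simp only [mul_apply, Matrix.map_apply, ← Algebra.smul_def, mul_comm _ (algebraMap R S _),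
      map_sum, map_smul, Finsupp.coe_finsetSum, Finset.sum_apply, Finsupp.smul_apply,
      smul_eq_mul] at this
    simp only [X, mul_apply, Matrix.map_apply]
    rw [← this]
    exact Finset.sum_congr rfl fun _ _ => mul_comm _ _
  let T : Finset κ := Finset.univ.biUnion fun i => Finset.univ.biUnion fun p =>
    Finset.univ.biUnion fun q => (b.repr (e i p q)).support
  have hT : ∀ i p q, ρ (e i p q) = ∑ j ∈ T, ρ (b j) * algebraMap k K (π (X j i p q)) := by
    intro i p q
    have hsub : (b.repr (e i p q)).support ⊆ T := fun j hj => by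
      simp only [T, Finset.mem_biUnion, Finset.mem_univ, true_and]
      exact ⟨i, p, q, hj⟩
    conv_lhs => rw [← b.linearCombination_repr (e i p q), Finsupp.linearCombination_apply,
      Finsupp.sum_of_support_subset _ hsub _ (by simp)]
    rw [map_sum]
    refine Finset.sum_congr rfl fun j _ => ?_
    rw [Algebra.smul_def, map_mul, hρ, mul_comm]
    rfl
  have hsum : blockMap ρ e =
      ∑ j ∈ T, ρ (b j) • (algebraMap k K).mapMatrix (blockMap π (X j)) := by
    ext ⟨i, p⟩ ⟨j, q⟩
    rw [Matrix.sum_apply]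
    simp only [blockMap_apply]
    by_cases hij : i = j
    · subst hij
      simp [blockDiagonal'_apply, hT]
    · simp [blockDiagonal'_apply, hij]
  rw [hsum]
  exact Submodule.sum_mem _ fun j _ => Submodule.smul_mem _ _ (Submodule.subset_span
    ⟨_, ⟨X j, hX j, rfl⟩, rfl⟩)

theorem coe_prod_det_map (g : QGl I α R) :
    ((∏ i : I, Units.map Matrix.detMonoidHom
        (Units.map ((π : R →+* k).mapMatrix).toMonoidHom (g i)) : kˣ) : k) =
      (blockMap π fun i => (g i).val).det := by
  rw [det_blockMap, Units.coe_prod]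
  refine Finset.prod_congr rfl fun i _ => ?_
  exact (π.map_det (g i).val).symm

theorem not_qDecomposable_iff_oneChi_eq_one [Finite k] [Module.Finite k R] [Algebra k S]
    [IsScalarTower k R S] [IsScalarTower k K S] [IsAlgClosed K] [IsLocalRing S]
    [Nonempty (Σ i, Fin (α i))]
    (hπ : ∀ x, π x ≠ 0 → IsUnit x)
    (hρ : ∀ r, ρ (algebraMap R S r) = algebraMap k K (π r))
    (hρ' : ∀ x, ρ x ≠ 0 → IsUnit x) {κ : Type} (b : Module.Basis κ R S)
    (hk : ((∑ i, α i : ℕ) : k) ≠ 0) (χ : kˣ →* ℂˣ) (hχ : orderOf χ = ∑ i, α i)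
    (M : QRep I E s t α R) :
    ¬ QDecomposable s t α S (fun a => (M a).map (algebraMap R S)) ↔
      ∀ g : QGl I α R, QAct s t α g M = M → oneChi (π : R →+* k) χ g = 1 := by
  have hcard : Fintype.card (Σ i, Fin (α i)) = ∑ i, α i := by simp
  rw [qDecomposable_iff]
  constructor
  · intro h g hg
    rw [QAct_eq_self_iff] at hg
    let gS : ∀ i, Matrix (Fin (α i)) (Fin (α i)) S := fun i => (g i).val.map (algebraMap R S)
    have hgS : gS ∈ QEnd K (fun a => (M a).map (algebraMap R S) : QRep I E s t α S) := fun a => by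
      have := congrArg (fun x => x.map (algebraMap R S)) (hg a)
      simpa only [Matrix.map_mul] using this
    have hgint : IsIntegral K gS := by
      have h1 : IsIntegral k (fun i => (g i).val : ∀ i, Matrix (Fin (α i)) (Fin (α i)) R) :=
        IsIntegral.of_finite k _
      refine h1.map_of_comp_eq (algebraMap k K) (RingHom.pi fun i =>
        (algebraMap R S).mapMatrix.comp (Pi.evalRingHom _ i)) ?_
      ext r i p q
      have hr : algebraMap K S (algebraMap k K r) = algebraMap R S (algebraMap k R r) := by
        rw [← IsScalarTower.algebraMap_apply, ← IsScalarTower.algebraMap_apply]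
      by_cases hpq : p = q <;> simp [algebraMap_matrix_apply, hpq, hr]
    have hmem : ∀ f : Polynomial K, Polynomial.aeval gS f ∈ QEnd K
        (fun a => (M a).map (algebraMap R S) : QRep I E s t α S) := fun f =>
      Algebra.adjoin_le (Set.singleton_subset_iff.mpr hgS)
        (Polynomial.aeval_mem_adjoin_singleton K gS)
    obtain ⟨c, hc⟩ := exists_det_eq_pow_card (K := K) (by rwa [hcard])
      (blockMap π fun i => (g i).val) (by
        rw [← blockMap_map π ρ hρ]
        intro c hc d hd
        by_contra hcd
        obtain ⟨f, hf, hf0, hf1⟩ := exists_isIdempotentElem_aeval (blockMap ρ) hgint hc hd hcd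
        exact h ⟨_, hmem f, hf, hf0, hf1⟩)
    rw [← coe_prod_det_map, hcard] at hc
    have hn : ∑ i, α i ≠ 0 := fun h0 => hk (by rw [h0, Nat.cast_zero])
    have hc0 : c ≠ 0 := by
      rintro rfl
      rw [zero_pow hn] at hc
      exact Units.ne_zero _ hc
    have hu : (∏ i : I, Units.map Matrix.detMonoidHom
        (Units.map ((π : R →+* k).mapMatrix).toMonoidHom (g i)) : kˣ) =
        Units.mk0 c hc0 ^ (∑ i, α i) := by
      ext1
      rw [hc, Units.val_pow_eq_pow_val, Units.val_mk0]
    rw [oneChi, hu, map_pow, ← MonoidHom.pow_apply, ← hχ, pow_orderOf_eq_one,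
      MonoidHom.one_apply]
  · rintro h ⟨e, he, hidem, he0, he1⟩
    have := eq_zero_or_eq_one_of_mem_span ((QEnd k M).map (blockMap π)) χ (by rw [hχ, hcard]) ?_
      (hidem.map (blockMap ρ)) (blockMap_mem_span π ρ hρ b M he)
    · rcases this with h0 | h1
      · exact he0 (eq_zero_of_blockMap_eq_zero ρ hρ' hidem h0)
      · exact he1 (eq_one_of_blockMap_eq_one ρ hρ' hidem h1)
    · rintro _ ⟨X, hX, rfl⟩ u hu
      have hu' : (blockMap π X).det = u := hu
      have hunit : ∀ i, IsUnit (X i) := fun i => by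
        rw [isUnit_iff_isUnit_det]
        refine hπ _ fun h0 => u.ne_zero ?_
        rw [← hu', det_blockMap, Finset.prod_eq_zero (Finset.mem_univ i) h0]
      choose g hg using hunit
      obtain rfl : (fun i => (g i).val) = X := funext hg
      rw [← h g ((QAct_eq_self_iff M g).mpr hX), oneChi]
      congr 1
      ext1
      rw [← hu', coe_prod_det_map]

end BaseChange

section TensorProduct

variable {k R K : Type} [Field k] [CommRing R] [Algebra k R] [Field K] [Algebra k K]

open TensorProduct in
theorem isNilpotent_of_lift_eq_zero (π : R →ₐ[k] k) (hπ : ∀ r, π r = 0 → IsNilpotent r)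
    (x : R ⊗[k] K)
    (hx : Algebra.TensorProduct.lift ((Algebra.ofId k K).comp π) (AlgHom.id k K)
      (fun _ _ => Commute.all _ _) x = 0) : IsNilpotent x := by
  let b := Module.Basis.ofVectorSpace k K
  let B := Algebra.TensorProduct.basis R b
  have hB : x = ∑ j ∈ (B.repr x).support, B.repr x j • B j := by
    conv_lhs => rw [← B.linearCombination_repr x, Finsupp.linearCombination_apply]
    rfl
  have h0 : ∀ j ∈ (B.repr x).support, π (B.repr x j) = 0 := by
    refine linearIndependent_iff'.mp b.linearIndependent _ _ ?_
    rw [← hx]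
    conv_rhs => rw [hB]
    rw [map_sum]
    refine Finset.sum_congr rfl fun j _ => ?_
    rw [Algebra.TensorProduct.basis_apply, TensorProduct.smul_tmul', smul_eq_mul, mul_one,
      Algebra.TensorProduct.lift_tmul, Algebra.smul_def]
    rfl
  rw [hB]
  refine isNilpotent_sum fun j hj => ?_
  rw [Algebra.smul_def]
  exact (Commute.all _ _).isNilpotent_mul_right ((hπ _ (h0 j hj)).map (algebraMap R (R ⊗[k] K)))

end TensorProduct

theorem qAbsInd_iff_oneChi_eq_one {I E : Type} [Fintype I] {s t : E → I} {α : I → ℕ}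
    {k R : Type} [Field k] [Finite k] [CommRing R] [IsLocalRing R] [Algebra k R]
    [Module.Finite k R] (π : R →ₐ[k] k) (hπ : ∀ r, π r = 0 ↔ r ∈ IsLocalRing.maximalIdeal R)
    (hk : ((∑ i, α i : ℕ) : k) ≠ 0) (χ : kˣ →* ℂˣ) (hχ : orderOf χ = ∑ i, α i)
    (M : QRep I E s t α R) :
    QAbsInd k s t α R M ↔
      ∀ g : QGl I α R, QAct s t α g M = M → oneChi (π : R →+* k) χ g = 1 := by
  classical
  let K := AlgebraicClosure k
  let : Algebra K (TensorProduct k R K) := Algebra.TensorProduct.rightAlgebra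
  have : IsArtinianRing R := IsArtinianRing.of_finite k R
  have hπn : ∀ r, π r = 0 → IsNilpotent r := fun r hr => by
    exact Ring.KrullDimLE.isNilpotent_iff_mem_maximalIdeal.mpr ((hπ r).mp hr)
  let ρ₀ : TensorProduct k R K →ₐ[k] K := Algebra.TensorProduct.lift ((Algebra.ofId k K).comp π)
    (AlgHom.id k K) (fun _ _ => Commute.all _ _)
  let ρ : TensorProduct k R K →ₐ[K] K :=
    { ρ₀ with
      commutes' := fun c => by
        show ρ₀ (1 ⊗ₜ c) = c
        simp [ρ₀] }
  have hρ' : ∀ x, ρ x ≠ 0 → IsUnit x := fun x hx => by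
    have h1 : IsNilpotent (x - algebraMap K _ (ρ x)) := by
      refine isNilpotent_of_lift_eq_zero π hπn _ ?_
      show ρ (x - algebraMap K _ (ρ x)) = 0
      rw [map_sub, AlgHom.commutes]
      exact sub_self _
    have h2 : IsUnit (algebraMap K (TensorProduct k R K) (ρ x)) := (IsUnit.mk0 _ hx).map _
    simpa using h1.isUnit_add_left_of_commute h2 (Commute.all _ _)
  have : IsLocalHom (ρ : TensorProduct k R K →+* K) := ⟨fun x hx => hρ' x hx.ne_zero⟩
  have : IsLocalRing (TensorProduct k R K) := RingHom.domain_isLocalRing (ρ : _ →+* K)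
  have hne : Nonempty (Σ i, Fin (α i)) := by
    rw [← Fintype.card_pos_iff, Fintype.card_sigma]
    simp only [Fintype.card_fin]
    exact Nat.pos_of_ne_zero fun h0 => hk (by rw [h0, Nat.cast_zero])
  have hR : ∀ r, π r ≠ 0 → IsUnit r := fun r hr => by
    by_contra hu
    exact hr ((hπ r).mpr hu)
  exact not_qDecomposable_iff_oneChi_eq_one π ρ hR
    (fun r => by
      show ρ₀ (r ⊗ₜ 1) = _
      simp [ρ₀, Algebra.ofId_apply])
    hρ' (Algebra.TensorProduct.basis R (Module.Basis.ofVectorSpace k K)) hk χ hχ M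

/-- The dimension of the `1^χ`-isotypical component of `ℂ[Rep^α(Q,R)]` equals the number
`a_α(RQ)` of isomorphism classes of absolutely indecomposable representations, for `R` a
split local Frobenius algebra over a finite field `k` containing a primitive `|α|`-th root
of unity, and `χ : k× → ℂ×` of order exactly `|α|`. -/
theorem dim_isotypic_component_eq_number_of_abs_indecomposables
    (k : Type) [Field k] [Fintype k]
    (R : Type) [CommRing R] [Algebra k R] [FiniteDimensional k R] [IsLocalRing R]
    (π : R →+* k) (hπ : ∀ c : k, π (algebraMap k R c) = c)
    (hker : ∀ r : R, π r = 0 ↔ r ∈ IsLocalRing.maximalIdeal R)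
    (lam : R →ₗ[k] k) (hlam : ∀ J : Ideal R, J ≠ ⊥ → ∃ x ∈ J, lam x ≠ 0)
    (I E : Type) [Fintype I] [Fintype E] (s t : E → I) (α : I → ℕ)
    (ζ : k) (hζ : IsPrimitiveRoot ζ (∑ i, α i))
    (χ : kˣ →* ℂˣ) (hχ : orderOf χ = ∑ i, α i) :
    Module.finrank ℂ
      ↥(⨅ g : QGl I α R, LinearMap.ker
          (LinearMap.funLeft ℂ ℂ (fun x : QRep I E s t α R => QAct s t α g⁻¹ x)
            - ((oneChi π χ g : ℂˣ) : ℂ) • (LinearMap.id : (QRep I E s t α R → ℂ) →ₗ[ℂ] (QRep I E s t α R → ℂ)))) =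
    aOrbits k I E s t α R := by
  have : Finite R := Module.finite_of_finite k
  have : Finite (QRep I E s t α R) := inferInstanceAs (Finite (∀ a : E, Fin _ → Fin _ → R))
  let ψ : QGl I α R →* ℂˣ :=
    { toFun := oneChi π χ
      map_one' := by simp [oneChi]
      map_mul' := fun g h => by simp [oneChi, Finset.prod_mul_distrib] }
  have act_one : ∀ M : QRep I E s t α R, QAct s t α 1 M = M := fun M =>
    (QAct_eq_self_iff M 1).mpr fun a => by simp
  have act_mul : ∀ (g h : QGl I α R) (M : QRep I E s t α R),
      QAct s t α (g * h) M = QAct s t α g (QAct s t α h M) := by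
    intro g h M
    funext a
    show (g (t a)).val * (h (t a)).val * M a * ((h (s a)).inv * (g (s a)).inv) = _
    simp only [QAct, Matrix.mul_assoc]
  refine (finrank_isotypic_eq_card (QAct s t α) ψ act_one act_mul).trans ?_
  have hord : ∑ i, α i ≠ 0 := by
    rw [← hχ]
    refine (orderOf_pos_iff.mpr (isOfFinOrder_iff_pow_eq_one.mpr
      ⟨Nat.card kˣ, Nat.card_pos, ?_⟩)).ne'
    ext1 u
    rw [MonoidHom.pow_apply, ← map_pow, pow_card_eq_one', map_one, MonoidHom.one_apply]
  have hk : ((∑ i, α i : ℕ) : k) ≠ 0 := by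
    have : NeZero (∑ i, α i) := ⟨hord⟩
    exact hζ.neZero'.out
  let π' : R →ₐ[k] k := { π with commutes' := hπ }
  refine Nat.card_congr (Equiv.subtypeEquivRight fun O => exists_congr fun M =>
    and_congr (qAbsInd_iff_oneChi_eq_one π' hker hk χ hχ M).symm Iff.rfl)
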